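/- arXiv:1806.08745 — 3 statements merged into one kernel-verified Lean document; each statement's English description precedes it below -/
import Mathlib

section
/- Let ζ₁ = Σ_{j<0} (√2)^j e_{(j,j)} and ζ₂ = e_{(0,0)} in ℓ²(ℤ×ℤ). Let s : ℤ → ℂ be s(j) = 1 if j < 0 and s(j) = −1 if j ≥ 0. Let Û be the unitary operator on ℓ²(ℤ×ℤ) given by (Ûf)(j,k) = f(j−1, k−1) (representing U ⊗ U for the bilateral shift U on ℓ²(ℤ)), let T̂_A be the unitary operator (T̂_A f)(j,k) = s(j)·f(j,k) (representing T ⊗ I for the self-adjoint unitary T e_j = s(j) e_j), and let T̂_B be the unitary operator (T̂_B f)(j,k) = s(k)·f(j,k) (representing I ⊗ T). Then ζ₁ and ζ₂ are unit vectors and: ⟨Ûζ₁, ζ₂⟩ = ⟨Ûζ₁, ζ₁⟩ = 1/√2; ⟨T̂_A ζ₁, ζ₁⟩ = ⟨T̂_B ζ₁, ζ₁⟩ = 1; and ⟨T̂_A ζ₂, ζ₂⟩ = ⟨T̂_B ζ₂, ζ₂⟩ = −1. -/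
/-- Inner product on `ℓ²(ℤ×ℤ)` (realized as functions `ℤ × ℤ → ℂ`), linear in the
first argument and conjugate-linear in the second. -/
noncomputable def ip (f g : ℤ × ℤ → ℂ) : ℂ :=
  ∑' p : ℤ × ℤ, f p * (starRingEnd ℂ) (g p)

/-- `ζ₁ = Σ_{j<0} (√2)^j e_{(j,j)}`. -/
noncomputable def zeta1 : ℤ × ℤ → ℂ := fun p =>
  if p.2 = p.1 ∧ p.1 < 0 then (Real.sqrt 2 : ℂ) ^ p.1 else 0

/-- `ζ₂ = e_{(0,0)}`. -/
noncomputable def zeta2 : ℤ × ℤ → ℂ := fun p =>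
  if p = (0, 0) then 1 else 0

/-- The sign function: `s(j) = 1` if `j < 0` and `s(j) = -1` if `j ≥ 0`. -/
noncomputable def sgn (j : ℤ) : ℂ := if j < 0 then 1 else -1

/-- `Û = U ⊗ U`, where `U` is the bilateral shift: `(Ûf)(j,k) = f(j-1, k-1)`. -/
noncomputable def Uhat (f : ℤ × ℤ → ℂ) : ℤ × ℤ → ℂ := fun p => f (p.1 - 1, p.2 - 1)

/-- `T̂_A = T ⊗ I`, where `T e_j = s(j) e_j`: `(T̂_A f)(j,k) = s(j) f(j,k)`. -/
noncomputable def That_A (f : ℤ × ℤ → ℂ) : ℤ × ℤ → ℂ := fun p => sgn p.1 * f p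

/-- `T̂_B = I ⊗ T`: `(T̂_B f)(j,k) = s(k) f(j,k)`. -/
noncomputable def That_B (f : ℤ × ℤ → ℂ) : ℤ × ℤ → ℂ := fun p => sgn p.2 * f p

/-- `1/√2` as a complex number. -/
noncomputable def invSqrt2 : ℂ := 1 / (Real.sqrt 2 : ℂ)

/-- The index `(-(n+1), -(n+1))` of the `n`-th basis vector occurring in `ζ₁`. -/
def negDiag (n : ℕ) : ℤ × ℤ := (-(n + 1 : ℤ), -(n + 1 : ℤ))

theorem negDiag_injective : Function.Injective negDiag := by
  intro m n h
  simp only [negDiag, Prod.mk.injEq] at h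
  omega

theorem zeta1_eq_zero {p : ℤ × ℤ} (hp : p ∉ Set.range negDiag) : zeta1 p = 0 := by
  refine if_neg fun h => hp ⟨(-p.1 - 1).toNat, ?_⟩
  ext <;> simp only [negDiag] <;> omega

theorem zeta1_negDiag (n : ℕ) : zeta1 (negDiag n) = ((Real.sqrt 2 : ℂ) ^ (n + 1))⁻¹ := by
  have h : -(n + 1 : ℤ) < 0 := by omega
  simp only [zeta1, negDiag, h, and_self, if_true, zpow_neg]
  norm_cast

theorem ofReal_sqrt_two_sq : (Real.sqrt 2 : ℂ) ^ 2 = 2 := by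
  norm_cast
  exact Real.sq_sqrt zero_le_two

theorem zeta1_negDiag_mul_conj (n : ℕ) :
    zeta1 (negDiag n) * (starRingEnd ℂ) (zeta1 (negDiag n)) = 1 / 2 / 2 ^ n := by
  rw [zeta1_negDiag, map_inv₀, map_pow, Complex.conj_ofReal, ← mul_inv, ← mul_pow, ← sq,
    ofReal_sqrt_two_sq, pow_succ]
  field_simp

/-- If `f` is `c • ζ₁` on the support of `ζ₁`, then `⟨f, ζ₁⟩ = c`. -/
theorem ip_zeta1_of_eq_mul {f : ℤ × ℤ → ℂ} {c : ℂ}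
    (h : ∀ n, f (negDiag n) = c * zeta1 (negDiag n)) : ip f zeta1 = c := by
  have hs : Function.support (fun p => f p * (starRingEnd ℂ) (zeta1 p)) ⊆
      Set.range negDiag := by
    intro p hp
    by_contra hn
    exact hp (by simp [zeta1_eq_zero hn])
  rw [ip, ← negDiag_injective.tsum_eq hs]
  simp only [h, mul_assoc, zeta1_negDiag_mul_conj]
  have hg : HasSum (fun n : ℕ => (1 : ℂ) / 2 / 2 ^ n) 1 := by
    simpa using Complex.hasSum_ofReal.2 (hasSum_geometric_two' 1)
  rw [tsum_mul_left, hg.tsum_eq, mul_one]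

theorem ip_zeta2 (f : ℤ × ℤ → ℂ) : ip f zeta2 = f (0, 0) := by
  rw [ip, tsum_eq_single (0, 0)]
  · simp [zeta2]
  · intro p hp
    simp [zeta2, hp]

theorem sgn_negDiag (n : ℕ) : sgn (-(n + 1 : ℤ)) = 1 :=
  if_pos (by omega)

theorem Uhat_zeta1_negDiag (n : ℕ) :
    Uhat zeta1 (negDiag n) = invSqrt2 * zeta1 (negDiag n) := by
  have h : Uhat zeta1 (negDiag n) = zeta1 (negDiag (n + 1)) := by
    simp only [Uhat, negDiag]
    congr 2
  rw [h, zeta1_negDiag, zeta1_negDiag, invSqrt2, pow_succ _ (n + 1), mul_inv, mul_comm, one_div]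

/-- Proposition 1.5 of the paper: the explicit representation of the correlations of
Theorem 1.4 on `ℓ²(ℤ) ⊗ ℓ²(ℤ) ≅ ℓ²(ℤ×ℤ)`. -/
theorem stmt1 :
    ip zeta1 zeta1 = 1 ∧ ip zeta2 zeta2 = 1 ∧
    ip (Uhat zeta1) zeta2 = invSqrt2 ∧
    ip (Uhat zeta1) zeta1 = invSqrt2 ∧
    ip (That_A zeta1) zeta1 = 1 ∧
    ip (That_B zeta1) zeta1 = 1 ∧
    ip (That_A zeta2) zeta2 = -1 ∧
    ip (That_B zeta2) zeta2 = -1 := by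
  refine ⟨ip_zeta1_of_eq_mul fun n => (one_mul _).symm, ?_, ?_,
    ip_zeta1_of_eq_mul Uhat_zeta1_negDiag,
    ip_zeta1_of_eq_mul fun n => congrArg (· * _) (sgn_negDiag n),
    ip_zeta1_of_eq_mul fun n => congrArg (· * _) (sgn_negDiag n), ?_, ?_⟩
  · simp [ip_zeta2, zeta2]
  · simp [ip_zeta2, Uhat, zeta1, invSqrt2]
  · simp [ip_zeta2, That_A, zeta2, sgn]
  · simp [ip_zeta2, That_B, zeta2, sgn]
end

section
/- Let ζ₁ = Σ_{j<0} (√2)^j e_{(j,j)}, ζ₂ = e_{(0,0)}, ζ₃ = Σ_{j>0} (√2)^{−j} e_{(j,j)} in ℓ²(ℤ×ℤ). Let s(j) = 1 if j < 0 and s(j) = −1 if j ≥ 0. Define unitary operators on ℓ²(ℤ×ℤ): (R₂f)(j,k) = f(1−j, 1−k) (representing S₂ ⊗ S₂ where S₂ e_j = e_{−j+1}); (R₃f)(j,k) = f(−j, −k) (representing S₃ ⊗ S₃ where S₃ e_j = e_{−j}); (M_A f)(j,k) = s(j) f(j,k) (representing S₁ ⊗ I where S₁ e_j = s(j) e_j);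 and (M_B f)(j,k) = s(k) f(j,k) (representing I ⊗ S₁). Then the 3×3 matrices of inner products satisfy: (⟨R₂ ζ_l, ζ_i⟩)_{i,l} = [[0,0,1/√2],[0,0,1/√2],[1/√2,1/√2,0]]; (⟨R₃ ζ_l, ζ_i⟩)_{i,l} = [[0,0,1],[0,1,0],[1,0,0]]; and (⟨M_A ζ_l, ζ_i⟩)_{i,l} = (⟨M_B ζ_l, ζ_i⟩)_{i,l} = diag(1,−1,−1). (This is the explicit element of C_qs^{(3)}(3,2) constructed in Theorem 2.1 of the paper.) -/
/-- The vectors `ζ₁ = Σ_{j<0} (√2)^j e_{(j,j)}`, `ζ₂ = e_{(0,0)}`,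
`ζ₃ = Σ_{j>0} (√2)^{-j} e_{(j,j)}`, indexed by `Fin 3`. -/
noncomputable def zeta : Fin 3 → ℤ × ℤ → ℂ
  | 0 => fun p => if p.2 = p.1 ∧ p.1 < 0 then (Real.sqrt 2 : ℂ) ^ p.1 else 0
  | 1 => fun p => if p = (0, 0) then 1 else 0
  | 2 => fun p => if p.2 = p.1 ∧ 0 < p.1 then (Real.sqrt 2 : ℂ) ^ (-p.1) else 0

/-- `R₂ = S₂ ⊗ S₂`, where `S₂ e_j = e_{-j+1}`: `(R₂ f)(j,k) = f(1-j, 1-k)`. -/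
noncomputable def R2 (f : ℤ × ℤ → ℂ) : ℤ × ℤ → ℂ := fun p => f (1 - p.1, 1 - p.2)

/-- `R₃ = S₃ ⊗ S₃`, where `S₃ e_j = e_{-j}`: `(R₃ f)(j,k) = f(-j, -k)`. -/
noncomputable def R3 (f : ℤ × ℤ → ℂ) : ℤ × ℤ → ℂ := fun p => f (-p.1, -p.2)

/-- `M_A = S₁ ⊗ I`, where `S₁ e_j = s(j) e_j`: `(M_A f)(j,k) = s(j) f(j,k)`. -/
noncomputable def M_A (f : ℤ × ℤ → ℂ) : ℤ × ℤ → ℂ := fun p => sgn p.1 * f p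

/-- `M_B = I ⊗ S₁`: `(M_B f)(j,k) = s(k) f(j,k)`. -/
noncomputable def M_B (f : ℤ × ℤ → ℂ) : ℤ × ℤ → ℂ := fun p => sgn p.2 * f p

theorem invSqrt2_mul_self : invSqrt2 * invSqrt2 = 1 / 2 := by
  have h : (Real.sqrt 2 : ℂ) * (Real.sqrt 2 : ℂ) = 2 := by
    exact_mod_cast Real.mul_self_sqrt (show (0 : ℝ) ≤ 2 by norm_num)
  rw [invSqrt2, div_mul_div_comm, h, one_mul]

theorem conj_invSqrt2 : (starRingEnd ℂ) invSqrt2 = invSqrt2 := by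
  simp [invSqrt2]

theorem sqrt_two_zpow_neg_succ (n : ℕ) :
    (Real.sqrt 2 : ℂ) ^ (-((n : ℤ) + 1)) = invSqrt2 ^ (n + 1) := by
  rw [invSqrt2, one_div, inv_pow, zpow_neg]
  norm_cast

theorem hasSum_half_pow_succ : HasSum (fun n : ℕ => (1 / 2 : ℂ) ^ (n + 1)) 1 := by
  have h := (hasSum_geometric_of_norm_lt_one (ξ := (1 / 2 : ℂ)) (by norm_num)).mul_left (1 / 2)
  rw [show (1 / 2 : ℂ) * (1 - 1 / 2)⁻¹ = 1 by norm_num] at h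
  simpa only [pow_succ'] using h

theorem invSqrt2_pow_mul_pow (n : ℕ) : invSqrt2 ^ n * invSqrt2 ^ n = (1 / 2) ^ n := by
  rw [← mul_pow, invSqrt2_mul_self]

theorem tsum_invSqrt2_pow_succ_mul_self :
    ∑' n : ℕ, invSqrt2 ^ (n + 1) * invSqrt2 ^ (n + 1) = 1 := by
  simp_rw [invSqrt2_pow_mul_pow]
  exact hasSum_half_pow_succ.tsum_eq

theorem hasSum_invSqrt2_pow_add_two_mul :
    HasSum (fun n : ℕ => invSqrt2 ^ (n + 2) * invSqrt2 ^ (n + 1)) invSqrt2 := by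
  have h := hasSum_half_pow_succ.mul_left invSqrt2
  simp_rw [← invSqrt2_pow_mul_pow, ← mul_assoc, ← pow_succ', mul_one] at h
  exact h

theorem tsum_shifted_mul_invSqrt2_pow {f : ℕ → ℂ} (hf₀ : f 0 = 0)
    (hf : ∀ n, f (n + 1) = invSqrt2 ^ (n + 1)) : ∑' n, f n * invSqrt2 ^ (n + 1) = invSqrt2 := by
  have h : HasSum (fun n => f (n + 1) * invSqrt2 ^ (n + 1 + 1)) invSqrt2 := by
    simp_rw [hf]
    exact (funext fun n => mul_comm _ _ :
      (fun n => invSqrt2 ^ (n + 2) * invSqrt2 ^ (n + 1)) = _) ▸ hasSum_invSqrt2_pow_add_two_mul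
  rw [tsum_eq_zero_add' (f := fun n => f n * invSqrt2 ^ (n + 1)) h.summable, h.tsum_eq, hf₀,
    zero_mul, zero_add]

theorem zeta_zero_neg_succ (n : ℕ) :
    zeta 0 (-((n : ℤ) + 1), -((n : ℤ) + 1)) = invSqrt2 ^ (n + 1) := by
  rw [← sqrt_two_zpow_neg_succ]
  exact if_pos ⟨rfl, by dsimp only; omega⟩

theorem zeta_two_succ (n : ℕ) :
    zeta 2 ((n : ℤ) + 1, (n : ℤ) + 1) = invSqrt2 ^ (n + 1) := by
  rw [← sqrt_two_zpow_neg_succ]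
  exact if_pos ⟨rfl, by dsimp only; omega⟩

theorem zeta_zero_of_nonneg {j : ℤ} (k : ℤ) (hj : 0 ≤ j) : zeta 0 (j, k) = 0 :=
  if_neg fun h => absurd h.2 (not_lt.2 hj)

theorem zeta_two_of_nonpos {j : ℤ} (k : ℤ) (hj : j ≤ 0) : zeta 2 (j, k) = 0 :=
  if_neg fun h => absurd h.2 (not_lt.2 hj)

theorem zeta_one_zero : zeta 1 (0, 0) = 1 := by
  simp [zeta]

theorem zeta_one_of_ne {j : ℤ} (k : ℤ) (hj : j ≠ 0) : zeta 1 (j, k) = 0 :=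
  if_neg fun h => hj (congrArg Prod.fst h)

theorem ip_zeta_one (f : ℤ × ℤ → ℂ) : ip f (zeta 1) = f (0, 0) := by
  rw [ip, tsum_eq_single (0, 0)]
  · simp [zeta_one_zero]
  · intro p hp
    simp [zeta, hp]

theorem ip_zeta_zero (f : ℤ × ℤ → ℂ) :
    ip f (zeta 0) = ∑' n : ℕ, f (-((n : ℤ) + 1), -((n : ℤ) + 1)) * invSqrt2 ^ (n + 1) := by
  have hinj : Function.Injective fun n : ℕ => (-((n : ℤ) + 1), -((n : ℤ) + 1)) := by
    intro a b h
    have := congrArg Prod.fst h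
    dsimp only at this
    omega
  rw [ip, ← hinj.tsum_eq]
  · simp only [zeta_zero_neg_succ, map_pow, conj_invSqrt2]
  · rintro ⟨j, k⟩ hp
    by_cases h : k = j ∧ j < 0
    · refine ⟨(-j - 1).toNat, ?_⟩
      ext <;> dsimp only <;> omega
    · simp [zeta, h] at hp

theorem ip_zeta_two (f : ℤ × ℤ → ℂ) :
    ip f (zeta 2) = ∑' n : ℕ, f ((n : ℤ) + 1, (n : ℤ) + 1) * invSqrt2 ^ (n + 1) := by
  have hinj : Function.Injective fun n : ℕ => ((n : ℤ) + 1, (n : ℤ) + 1) := by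
    intro a b h
    have := congrArg Prod.fst h
    dsimp only at this
    omega
  rw [ip, ← hinj.tsum_eq]
  · simp only [zeta_two_succ, map_pow, conj_invSqrt2]
  · rintro ⟨j, k⟩ hp
    by_cases h : k = j ∧ 0 < j
    · refine ⟨(j - 1).toNat, ?_⟩
      ext <;> dsimp only <;> omega
    · simp [zeta, h] at hp

theorem tsum_mul_eq_zero {f g : ℕ → ℂ} (hf : ∀ n, f n = 0) : ∑' n, f n * g n = 0 := by
  simp [hf]

theorem ip_R2_zeta (i l : Fin 3) : ip (R2 (zeta l)) (zeta i) =
    !![0, 0, invSqrt2; 0, 0, invSqrt2; invSqrt2, invSqrt2, 0] i l := by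
  have h₂ (n : ℕ) : R2 (zeta 2) (-((n : ℤ) + 1), -((n : ℤ) + 1)) = invSqrt2 ^ (n + 2) := by
    rw [← zeta_two_succ (n + 1), R2]
    push_cast
    ring_nf
  have h₀ (n : ℕ) : R2 (zeta 0) (((n + 1 : ℕ) : ℤ) + 1, ((n + 1 : ℕ) : ℤ) + 1) =
      invSqrt2 ^ (n + 1) := by
    rw [← zeta_zero_neg_succ, R2]
    push_cast
    ring_nf
  fin_cases i <;> dsimp only [Fin.zero_eta, Fin.mk_one, Fin.reduceFinMk]
  · rw [ip_zeta_zero]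
    fin_cases l <;> dsimp only [Fin.zero_eta, Fin.mk_one, Fin.reduceFinMk]
    · exact tsum_mul_eq_zero fun n => zeta_zero_of_nonneg _ (by dsimp only; omega)
    · exact tsum_mul_eq_zero fun n => zeta_one_of_ne _ (by dsimp only; omega)
    · simp_rw [h₂]
      exact hasSum_invSqrt2_pow_add_two_mul.tsum_eq
  · rw [ip_zeta_one]
    fin_cases l <;> dsimp only [Fin.zero_eta, Fin.mk_one, Fin.reduceFinMk]
    · exact zeta_zero_of_nonneg _ (by norm_num)
    · exact zeta_one_of_ne _ (by norm_num)
    · simpa [R2] using zeta_two_succ 0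
  · rw [ip_zeta_two]
    fin_cases l <;> dsimp only [Fin.zero_eta, Fin.mk_one, Fin.reduceFinMk]
    · exact tsum_shifted_mul_invSqrt2_pow
        (f := fun n : ℕ => R2 (zeta 0) ((n : ℤ) + 1, (n : ℤ) + 1))
        (zeta_zero_of_nonneg _ (by norm_num)) h₀
    · rw [tsum_eq_single 0]
      · simp [R2, zeta_one_zero]
      · intro n hn
        rw [R2, zeta_one_of_ne _ (by dsimp only; omega), zero_mul]
    · exact tsum_mul_eq_zero fun n => zeta_two_of_nonpos _ (by dsimp only; omega)

theorem ip_R3_zeta (i l : Fin 3) : ip (R3 (zeta l)) (zeta i) =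
    !![0, 0, 1; 0, 1, 0; 1, 0, 0] i l := by
  fin_cases i <;> dsimp only [Fin.zero_eta, Fin.mk_one, Fin.reduceFinMk]
  · rw [ip_zeta_zero]
    fin_cases l <;> dsimp only [Fin.zero_eta, Fin.mk_one, Fin.reduceFinMk]
    · exact tsum_mul_eq_zero fun n => zeta_zero_of_nonneg _ (by dsimp only; omega)
    · exact tsum_mul_eq_zero fun n => zeta_one_of_ne _ (by dsimp only; omega)
    · simp_rw [R3, neg_neg, zeta_two_succ]
      exact tsum_invSqrt2_pow_succ_mul_self
  · rw [ip_zeta_one]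
    fin_cases l <;> dsimp only [Fin.zero_eta, Fin.mk_one, Fin.reduceFinMk]
    · exact zeta_zero_of_nonneg _ (by norm_num)
    · simp [R3, zeta_one_zero]
    · exact zeta_two_of_nonpos _ (by norm_num)
  · rw [ip_zeta_two]
    fin_cases l <;> dsimp only [Fin.zero_eta, Fin.mk_one, Fin.reduceFinMk]
    · simp_rw [R3, zeta_zero_neg_succ]
      exact tsum_invSqrt2_pow_succ_mul_self
    · exact tsum_mul_eq_zero fun n => zeta_one_of_ne _ (by dsimp only; omega)
    · exact tsum_mul_eq_zero fun n => zeta_two_of_nonpos _ (by dsimp only; omega)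

theorem ip_M_A_zeta (i l : Fin 3) : ip (M_A (zeta l)) (zeta i) =
    !![1, 0, 0; 0, -1, 0; 0, 0, -1] i l := by
  fin_cases i <;> dsimp only [Fin.zero_eta, Fin.mk_one, Fin.reduceFinMk]
  · have hs (n : ℕ) : sgn (-((n : ℤ) + 1)) = 1 := if_pos (by omega)
    simp_rw [ip_zeta_zero, M_A, hs, one_mul]
    fin_cases l <;> dsimp only [Fin.zero_eta, Fin.mk_one, Fin.reduceFinMk]
    · simp_rw [zeta_zero_neg_succ]
      exact tsum_invSqrt2_pow_succ_mul_self
    · exact tsum_mul_eq_zero fun n => zeta_one_of_ne _ (by omega)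
    · exact tsum_mul_eq_zero fun n => zeta_two_of_nonpos _ (by omega)
  · rw [ip_zeta_one]
    fin_cases l <;>
      simp [M_A, sgn, zeta_one_zero, zeta_zero_of_nonneg, zeta_two_of_nonpos]
  · have hs (n : ℕ) : sgn ((n : ℤ) + 1) = -1 := if_neg (by omega)
    simp_rw [ip_zeta_two, M_A, hs, mul_assoc, tsum_mul_left]
    fin_cases l <;> dsimp only [Fin.zero_eta, Fin.mk_one, Fin.reduceFinMk]
    · rw [tsum_mul_eq_zero fun n => zeta_zero_of_nonneg _ (by omega)]
      simp
    · rw [tsum_mul_eq_zero fun n => zeta_one_of_ne _ (by omega)]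
      simp
    · simp_rw [zeta_two_succ, tsum_invSqrt2_pow_succ_mul_self]
      simp

theorem M_B_zeta (l : Fin 3) : M_B (zeta l) = M_A (zeta l) := by
  ext ⟨j, k⟩
  by_cases h : k = j
  · rw [M_A, M_B, h]
  · have h₀ : zeta l (j, k) = 0 := by
      fin_cases l
      · exact if_neg fun h' => h h'.1
      · exact if_neg fun h' => h (by rw [Prod.mk.injEq] at h'; omega)
      · exact if_neg fun h' => h h'.1
    rw [M_A, M_B, h₀, mul_zero, mul_zero]

/-- The explicit element of `C_qs^{(3)}(3,2)` constructed in Theorem 2.1 of the paper: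
the matrices of inner products of the `ζ_i` against the operators `R₂`, `R₃`, `M_A`, `M_B`. -/
theorem stmt3 :
    (∀ i l : Fin 3, ip (R2 (zeta l)) (zeta i) =
      !![0, 0, invSqrt2; 0, 0, invSqrt2; invSqrt2, invSqrt2, 0] i l) ∧
    (∀ i l : Fin 3, ip (R3 (zeta l)) (zeta i) =
      !![0, 0, 1; 0, 1, 0; 1, 0, 0] i l) ∧
    (∀ i l : Fin 3, ip (M_A (zeta l)) (zeta i) =
      !![1, 0, 0; 0, -1, 0; 0, 0, -1] i l) ∧
    (∀ i l : Fin 3, ip (M_B (zeta l)) (zeta i) =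
      !![1, 0, 0; 0, -1, 0; 0, 0, -1] i l) := by
  exact ⟨ip_R2_zeta, ip_R3_zeta, ip_M_A_zeta,
    fun i l => (congrArg (ip · (zeta i)) (M_B_zeta l)).trans (ip_M_A_zeta i l)⟩
end

section
/- There exists an injective group homomorphism ι : ℤ₂ * ℤ → ℤ₂ * ℤ₃ such that ι(g) = g and ι(u) = hgh, where g denotes the generator of the ℤ₂ free factor (in both groups), u denotes a generator of the ℤ free factor of ℤ₂ * ℤ, and h denotes a generator of the ℤ₃ free factor of ℤ₂ * ℤ₃. -/
open Monoid

universe u v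

/-- The **ping-pong lemma** for the free product of two groups. -/
theorem Monoid.Coprod.lift_injective_of_ping_pong {A : Type u} {B : Type v} [Group A]
    [Group B] {G α : Type*} [Group G] [MulAction G α] [Infinite B] (f : A →* G) (k : B →* G)
    {X Y : Set α} (hX : X.Nonempty) (hY : Y.Nonempty) (hXY : Disjoint X Y)
    (hf : ∀ a : A, a ≠ 1 → ∀ y ∈ Y, f a • y ∈ X)
    (hk : ∀ b : B, b ≠ 1 → ∀ x ∈ X, k b • x ∈ Y) :
    Function.Injective (Coprod.lift f k) := by
  let H : Bool → Type (max u v) := fun b => bif b then ULift.{v} A else ULift.{u} B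
  let _ : ∀ b, Group (H b) := fun b => by cases b <;> dsimp only [H, cond] <;> infer_instance
  let F : ∀ b, H b →* G := fun b => match b with
    | true => f.comp (MulEquiv.ulift : ULift A ≃* A).toMonoidHom
    | false => k.comp (MulEquiv.ulift : ULift B ≃* B).toMonoidHom
  let e : Coprod A B →* CoprodI H :=
    Coprod.lift ((CoprodI.of (M := H) (i := true)).comp MulEquiv.ulift.symm.toMonoidHom)
      ((CoprodI.of (M := H) (i := false)).comp MulEquiv.ulift.symm.toMonoidHom)
  let r : CoprodI H →* Coprod A B := CoprodI.lift fun b => match b with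
    | true => Coprod.inl.comp (MulEquiv.ulift : ULift A ≃* A).toMonoidHom
    | false => Coprod.inr.comp (MulEquiv.ulift : ULift B ≃* B).toMonoidHom
  have hre : r.comp e = MonoidHom.id _ := by
    ext x
    · simp [r, e]
    · simp [r, e]
  have he : Function.Injective e :=
    Function.LeftInverse.injective (g := r) fun x => DFunLike.congr_fun hre x
  have hcomp : Coprod.lift f k = (CoprodI.lift F).comp e := by
    ext x
    · simp [e]; rfl
    · simp [e]; rfl
  rw [hcomp, MonoidHom.coe_comp]
  refine Function.Injective.comp ?_ he
  refine CoprodI.lift_injective_of_ping_pong F (Or.inr ⟨false, ?_⟩)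
    (fun b => bif b then X else Y) ?_ ?_ ?_
  · have : Infinite (H false) := inferInstanceAs (Infinite (ULift.{u} B))
    exact (Cardinal.natCast_le_aleph0 (n := 3)).trans (Cardinal.aleph0_le_mk _)
  · rintro (_ | _)
    exacts [hY, hX]
  · rintro (_ | _) (_ | _) h
    exacts [(h rfl).elim, hXY.symm, hXY, (h rfl).elim]
  · rintro (_ | _) (_ | _) h m hm
    · exact (h rfl).elim
    · rintro _ ⟨x, hx, rfl⟩
      exact hk m.down (fun h1 => hm (ULift.ext _ _ h1)) x hx
    · rintro _ ⟨x, hx, rfl⟩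
      exact hf m.down (fun h1 => hm (ULift.ext _ _ h1)) x hx
    · exact (h rfl).elim

/-- The homomorphism from the cyclic group of order `n` determined by an `n`-torsion element. -/
def zmodPowersHom {G : Type*} [Group G] (n : ℕ) (x : G) (hx : x ^ n = 1) :
    Multiplicative (ZMod n) →* G :=
  AddMonoidHom.toMultiplicativeLeft
    (ZMod.lift n ⟨zmultiplesHom (Additive G) (Additive.ofMul x), by
      simp [← ofMul_pow, hx]⟩)

@[simp]
theorem zmodPowersHom_ofAdd_one {G : Type*} [Group G] (n : ℕ) (x : G) (hx : x ^ n = 1) :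
    zmodPowersHom n x hx (Multiplicative.ofAdd 1) = x := by
  have := ZMod.lift_coe n ⟨zmultiplesHom (Additive G) (Additive.ofMul x), by
      simp [← ofMul_pow, hx]⟩ 1
  simp only [Int.cast_one] at this
  simp [zmodPowersHom, this]

/-- The Möbius transformation `x ↦ -1 / x` of the irrational numbers. -/
noncomputable def irrationalNegInv : Equiv.Perm {x : ℝ // Irrational x} :=
  Function.Involutive.toPerm (fun x => ⟨-(x : ℝ)⁻¹, x.2.inv.neg⟩) fun x => by
    ext
    simp

/-- The Möbius transformation `x ↦ 1 - 1 / x` of the irrational numbers. -/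
noncomputable def irrationalOneSubInv : Equiv.Perm {x : ℝ // Irrational x} where
  toFun x := ⟨1 - (x : ℝ)⁻¹, by simpa using x.2.inv.natCast_sub 1⟩
  invFun x := ⟨(1 - (x : ℝ))⁻¹, by simpa using (x.2.natCast_sub 1).inv⟩
  left_inv x := by
    ext
    simp
  right_inv x := by
    ext
    simp

theorem coe_irrationalNegInv (x : {x : ℝ // Irrational x}) :
    (irrationalNegInv x : ℝ) = -(x : ℝ)⁻¹ := rfl

theorem coe_irrationalOneSubInv (x : {x : ℝ // Irrational x}) :
    (irrationalOneSubInv x : ℝ) = 1 - (x : ℝ)⁻¹ := rfl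

theorem irrationalNegInv_sq : irrationalNegInv ^ 2 = 1 := by
  ext x
  simp [pow_two, coe_irrationalNegInv]

theorem irrationalOneSubInv_cube : irrationalOneSubInv ^ 3 = 1 := by
  ext x
  have h0 : (x : ℝ) ≠ 0 := x.2.ne_zero
  have h1 : (x : ℝ) - 1 ≠ 0 := sub_ne_zero.2 x.2.ne_one
  have h2 : 1 - (x : ℝ)⁻¹ = (x - 1) / x := by field_simp
  have h3 : 1 - (x / (x - 1) : ℝ) = -((x : ℝ) - 1)⁻¹ := by
    field_simp
    ring
  simp [pow_succ, coe_irrationalOneSubInv, h2, h3]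

/-- The Möbius transformation `x ↦ 2 - 1 / x` of the irrational numbers. -/
noncomputable def irrationalTwoSubInv : Equiv.Perm {x : ℝ // Irrational x} :=
  irrationalOneSubInv * irrationalNegInv * irrationalOneSubInv

theorem coe_irrationalTwoSubInv (x : {x : ℝ // Irrational x}) :
    (irrationalTwoSubInv x : ℝ) = 2 - (x : ℝ)⁻¹ := by
  simp [irrationalTwoSubInv, coe_irrationalNegInv, coe_irrationalOneSubInv]
  ring

theorem coe_irrationalTwoSubInv_inv (x : {x : ℝ // Irrational x}) :
    (irrationalTwoSubInv⁻¹ x : ℝ) = (2 - (x : ℝ))⁻¹ := by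
  have h := coe_irrationalTwoSubInv (irrationalTwoSubInv⁻¹ x)
  rw [← Equiv.Perm.mul_apply, mul_inv_cancel, Equiv.Perm.one_apply] at h
  rw [h]
  simp

theorem one_lt_irrationalTwoSubInv_pow (n : ℕ) {x : {x : ℝ // Irrational x}} (hx : (x : ℝ) < 0) :
    1 < ((irrationalTwoSubInv ^ (n + 1)) x : ℝ) := by
  induction n with
  | zero =>
    have := inv_lt_zero.2 hx
    rw [zero_add, pow_one, coe_irrationalTwoSubInv]
    linarith
  | succ n ih =>
    have := inv_lt_one_of_one_lt₀ ih
    rw [pow_succ', Equiv.Perm.mul_apply, coe_irrationalTwoSubInv]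
    linarith

theorem irrationalTwoSubInv_inv_pow_mem_Ioo (n : ℕ) {x : {x : ℝ // Irrational x}}
    (hx : (x : ℝ) < 0) : ((irrationalTwoSubInv⁻¹ ^ (n + 1)) x : ℝ) ∈ Set.Ioo 0 1 := by
  induction n with
  | zero =>
    rw [zero_add, pow_one, coe_irrationalTwoSubInv_inv]
    exact ⟨inv_pos.2 (by linarith), inv_lt_one_of_one_lt₀ (by linarith)⟩
  | succ n ih =>
    rw [pow_succ', Equiv.Perm.mul_apply, coe_irrationalTwoSubInv_inv]
    exact ⟨inv_pos.2 (by linarith [ih.2]), inv_lt_one_of_one_lt₀ (by linarith [ih.2])⟩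

theorem irrationalTwoSubInv_zpow_pos {n : ℤ} (hn : n ≠ 0) {x : {x : ℝ // Irrational x}}
    (hx : (x : ℝ) < 0) : 0 < ((irrationalTwoSubInv ^ n) x : ℝ) := by
  obtain ⟨m, rfl | rfl⟩ := n.eq_nat_or_neg <;> obtain _ | m := m
  · simp at hn
  · rw [zpow_natCast]
    exact zero_lt_one.trans (one_lt_irrationalTwoSubInv_pow m hx)
  · simp at hn
  · rw [zpow_neg, zpow_natCast, ← inv_pow]
    exact (irrationalTwoSubInv_inv_pow_mem_Ioo m hx).1

/-- Proposition 3.1 of the paper: there is an injective group homomorphism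
`ι : ℤ₂ ∗ ℤ → ℤ₂ ∗ ℤ₃` with `ι(g) = g` and `ι(u) = hgh`, where `g` generates the `ℤ₂`
factor, `u` generates the `ℤ` factor, and `h` generates the `ℤ₃` factor. -/
theorem stmt7 :
    ∃ ι : Coprod (Multiplicative (ZMod 2)) (Multiplicative ℤ) →*
          Coprod (Multiplicative (ZMod 2)) (Multiplicative (ZMod 3)),
      Function.Injective ι ∧
      ι (Coprod.inl (Multiplicative.ofAdd (1 : ZMod 2))) =
        Coprod.inl (Multiplicative.ofAdd (1 : ZMod 2)) ∧
      ι (Coprod.inr (Multiplicative.ofAdd (1 : ℤ))) =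
        Coprod.inr (Multiplicative.ofAdd (1 : ZMod 3)) *
          Coprod.inl (Multiplicative.ofAdd (1 : ZMod 2)) *
          Coprod.inr (Multiplicative.ofAdd (1 : ZMod 3)) := by
  let hgh : Coprod (Multiplicative (ZMod 2)) (Multiplicative (ZMod 3)) :=
    Coprod.inr (Multiplicative.ofAdd (1 : ZMod 3)) *
      Coprod.inl (Multiplicative.ofAdd (1 : ZMod 2)) *
      Coprod.inr (Multiplicative.ofAdd (1 : ZMod 3))
  let ψ : Coprod (Multiplicative (ZMod 2)) (Multiplicative (ZMod 3)) →*
      Equiv.Perm {x : ℝ // Irrational x} :=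
    Coprod.lift (zmodPowersHom 2 _ irrationalNegInv_sq)
      (zmodPowersHom 3 _ irrationalOneSubInv_cube)
  have hψ : ψ hgh = irrationalTwoSubInv := by
    simp [ψ, hgh, irrationalTwoSubInv]
  refine ⟨Coprod.lift Coprod.inl (zpowersHom _ hgh), ?_, by simp, by simp [hgh]⟩
  refine Function.Injective.of_comp (f := ψ) ?_
  rw [← MonoidHom.coe_comp, Coprod.comp_lift]
  have h2 := irrational_sqrt_two
  refine Coprod.lift_injective_of_ping_pong _ _
    (X := {x : {x : ℝ // Irrational x} | (x : ℝ) < 0}) (Y := {x | 0 < (x : ℝ)})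
    ⟨⟨-√2, h2.neg⟩, by simp⟩ ⟨⟨√2, h2⟩, by simp⟩
    (Set.disjoint_left.2 fun _ => lt_asymm (α := ℝ)) ?_ ?_
  · intro a ha y hy
    obtain rfl : a = Multiplicative.ofAdd 1 := by
      revert a
      decide
    simpa [ψ, coe_irrationalNegInv] using hy
  · intro b hb x hx
    simpa [hψ] using irrationalTwoSubInv_zpow_pos (n := b.toAdd) (by simpa using hb) hx
end
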